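/- Let n, k, δ be positive integers with k ≤ δ, k < n, ν = ⌊δ/k⌋ + 1, t = δ − k⌊δ/k⌋, and n ≥ k + 2δ − ν. Let F be a finite field with |F| = q, q odd, q ≥ 2n(ν+1) + 1, let α ∈ F have multiplicative order (q−1)/2, let b ∈ F be a nonsquare, and let C = [c_{ij}] with c_{ij} = 1/(1 − b·α^{j−i}) for 0 ≤ i, j ≤ (q−3)/2. Define coefficient vectors g_{j,r} = (c_{jn, r−1}, c_{jn+1, r−1}, …, c_{(j+1)n−1, r−1})ᵀ ∈ F^n for all pairs (j,r) with 0 ≤ j ≤ ν−1, 1 ≤ r ≤ k, and additionally for j = ν, 1 ≤ r ≤ t when t ≠ 0. Set G(z) = Σ_{i=0}^{µ} G_i z^i with G_i = [g_{i,1} … g_{i,k}] (where g_{ν,r} = 0 for r > t), µ = ν if t ≠ 0 and µ = ν−1 if t = 0. Then G(z) is the generator matrix of an MDS convolutional code of rate k/n and degree δ over F, i.e., Im_{F[z]} G(z) has degree δ and free distance (n−k)(⌊δ/k⌋+1) + δ + 1. -/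

import Mathlib

open Matrix Polynomial Finset

/-- A matrix over a field is superregular if every minor is nonzero. -/
def Superregular {F : Type*} [Field F] {r ℓ : ℕ} (A : Matrix (Fin r) (Fin ℓ) F) : Prop :=
  ∀ (s : ℕ) (f : Fin s → Fin r) (g : Fin s → Fin ℓ),
    StrictMono f → StrictMono g → (A.submatrix f g).det ≠ 0

/-- The maximal degree of the `k × k` minors of a polynomial matrix `G`. -/
noncomputable def maxMinorDeg {F : Type*} [Field F] {n k : ℕ}
    (G : Matrix (Fin n) (Fin k) (Polynomial F)) : ℕ :=
  Finset.univ.sup fun f : Fin k → Fin n => ((G.submatrix f id).det).natDegree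

/-- The weight of a polynomial vector: the total number of nonzero coefficients. -/
def polyWeight {F : Type*} [Field F] {n : ℕ} (v : Fin n → Polynomial F) : ℕ :=
  ∑ x : Fin n, (v x).support.card

/-- The free distance of the convolutional code generated by `G`: the minimal weight of a
nonzero codeword of `Im_{F[z]} G(z)`. -/
noncomputable def freeDist {F : Type*} [Field F] {n k : ℕ}
    (G : Matrix (Fin n) (Fin k) (Polynomial F)) : ℕ :=
  sInf {w : ℕ | ∃ u : Fin k → Polynomial F, G.mulVec u ≠ 0 ∧ w = polyWeight (G.mulVec u)}

/-- A nonzero combination of Cauchy columns has few zeros. -/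
lemma cauchy_zeros {F : Type*} [Field F] {ι κ : Type*} [DecidableEq ι] [DecidableEq κ]
    [DecidableEq F]
    (R : Finset ι) (S : Finset κ) (hS : S.Nonempty) (x : ι → F) (y : κ → F) (l : κ → F)
    (hx : Set.InjOn x R) (hy : Set.InjOn y S) (hl : ∀ j ∈ S, l j ≠ 0)
    (hxy : ∀ i ∈ R, ∀ j ∈ S, x i ≠ y j) :
    #R + 1 ≤ #{i ∈ R | ∑ j ∈ S, l j * (x i - y j)⁻¹ ≠ 0} + #S := by
  classical
  set P : F[X] := ∑ j ∈ S, C (l j) * ∏ m ∈ S.erase j, (X - C (y m)) with hP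
  have hdeg : P.natDegree ≤ #S - 1 := by
    refine natDegree_sum_le_of_forall_le _ _ fun j hj => ?_
    refine (natDegree_C_mul_le _ _).trans ?_
    rw [natDegree_prod_of_monic _ _ (fun m _ => monic_X_sub_C _)]
    simp [Finset.card_erase_of_mem hj]
  have hP0 : P ≠ 0 := by
    obtain ⟨j, hj⟩ := hS
    intro h
    have h1 : P.eval (y j) = l j * ∏ m ∈ S.erase j, (y j - y m) := by
      rw [hP, eval_finsetSum, Finset.sum_eq_single j]
      · simp [eval_prod]
      · intro m hm hmj
        rw [eval_mul, eval_prod, Finset.prod_eq_zero (i := j)]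
        · simp
        · simp [hj, Ne.symm hmj]
        · simp
      · intro h; exact absurd hj h
    rw [h, eval_zero] at h1
    have h2 := h1.symm
    rw [mul_eq_zero, Finset.prod_eq_zero_iff] at h2
    rcases h2 with h2 | ⟨m, hm, h2⟩
    · exact hl j hj h2
    · rw [Finset.mem_erase] at hm
      exact hm.1 (hy hm.2 hj (sub_eq_zero.mp h2).symm)
  have hz : ∀ i ∈ R, ∑ j ∈ S, l j * (x i - y j)⁻¹ = 0 → P.eval (x i) = 0 := by
    intro i hi h0
    have : P.eval (x i) = (∏ m ∈ S, (x i - y m)) * ∑ j ∈ S, l j * (x i - y j)⁻¹ := by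
      rw [hP, eval_finsetSum, Finset.mul_sum]
      refine Finset.sum_congr rfl fun j hj => ?_
      have hne : x i - y j ≠ 0 := sub_ne_zero.mpr (hxy i hi j hj)
      rw [← Finset.mul_prod_erase S _ hj]
      simp only [eval_mul, eval_C, eval_prod, eval_sub, eval_X]
      field_simp
    rw [this, h0, mul_zero]
  have hcard : #{i ∈ R | ¬ (∑ j ∈ S, l j * (x i - y j)⁻¹ ≠ 0)} ≤ #S - 1 := by
    refine le_trans ?_ hdeg
    rw [← Finset.card_image_of_injOn (f := x)
      (hx.mono (by intro i hi; exact (Finset.mem_filter.mp hi).1))]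
    refine Polynomial.card_le_degree_of_subset_roots ?_
    intro a ha
    simp only [Finset.mem_val, Finset.mem_image, Finset.mem_filter, not_not] at ha
    obtain ⟨i, ⟨hi, h0⟩, rfl⟩ := ha
    rw [mem_roots hP0]
    exact hz i hi h0
  have := Finset.card_filter_add_card_filter_not (s := R)
    (fun i => ∑ j ∈ S, l j * (x i - y j)⁻¹ ≠ 0)
  have := hS.card_pos
  omega

lemma alpha_zeros {F : Type*} [Field F] [DecidableEq F] {ι κ : Type*}
    [DecidableEq ι] [DecidableEq κ] (α b : F) (N : ℕ) (hα : orderOf α = N) (hα0 : α ≠ 0)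
    (hb : ∀ e f : ℕ, α ^ e ≠ b * α ^ f) (hb0 : b ≠ 0)
    (R : Finset ι) (S : Finset κ) (hS : S.Nonempty) (e : ι → ℕ) (f : κ → ℕ) (l : κ → F)
    (he : Set.InjOn e R) (hf : Set.InjOn f S) (heN : ∀ i ∈ R, e i < N) (hfN : ∀ j ∈ S, f j < N)
    (hl : ∀ j ∈ S, l j ≠ 0) :
    #R + 1 ≤ #{i ∈ R | ∑ j ∈ S, l j * (1 - b * α ^ ((f j : ℤ) - (e i : ℤ)))⁻¹ ≠ 0} + #S := by
  have hinj := pow_injOn_Iio_orderOf (x := α)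
  rw [hα] at hinj
  refine (cauchy_zeros R S hS (fun i => α ^ e i) (fun j => b * α ^ f j) l ?_ ?_ hl ?_).trans ?_
  · intro i hi j hj h
    exact he hi hj (hinj (heN i hi) (heN j hj) h)
  · intro i hi j hj h
    exact hf hi hj (hinj (hfN i hi) (hfN j hj) (mul_left_cancel₀ hb0 h))
  · intro i _ j _; exact hb _ _
  · refine Nat.add_le_add_right (Finset.card_le_card fun i hi => ?_) _
    rw [Finset.mem_filter] at hi ⊢
    refine ⟨hi.1, fun h' => hi.2 ?_⟩
    have : ∑ j ∈ S, l j * (1 - b * α ^ ((f j : ℤ) - (e i : ℤ)))⁻¹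
        = α ^ e i * ∑ j ∈ S, l j * (α ^ e i - b * α ^ f j)⁻¹ := by
      rw [Finset.mul_sum]
      refine Finset.sum_congr rfl fun j hj => ?_
      have h1 : α ^ e i ≠ 0 := pow_ne_zero _ hα0
      have h2 : α ^ e i - b * α ^ f j ≠ 0 := sub_ne_zero.mpr (hb _ _)
      have h3 : (1 - b * α ^ ((f j : ℤ) - (e i : ℤ))) = (α ^ e i - b * α ^ f j) / α ^ e i := by
        rw [zpow_sub₀ hα0, zpow_natCast, zpow_natCast]
        field_simp
      rw [h3, inv_div]
      field_simp
    rw [this] at h'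
    exact (mul_eq_zero.mp h').resolve_left (pow_ne_zero _ hα0)

lemma alpha_ne {F : Type*} [Field F] [Fintype F] {q : ℕ} (hq : Fintype.card F = q) (hodd : Odd q)
    (α : F) (hα : orderOf α = (q - 1) / 2)
    (b : F) (hb : ¬ IsSquare b) (e f : ℕ) : α ^ e ≠ b * α ^ f := by
  intro h
  have hc2 : ringChar F ≠ 2 := by
    intro h2
    have := FiniteField.even_card_of_char_two h2
    rw [hq] at this
    have := Nat.odd_iff.mp hodd
    omega
  have hb0 : b ≠ 0 := by rintro rfl; exact hb (IsSquare.zero)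
  rw [FiniteField.isSquare_iff hc2 hb0] at hb
  apply hb
  have hN : Fintype.card F / 2 = (q - 1) / 2 := by
    rw [hq]; obtain ⟨m, rfl⟩ := hodd; omega
  have hp : α ^ ((q - 1) / 2) = 1 := by rw [← hα]; exact pow_orderOf_eq_one α
  have h2 := congrArg (fun z => z ^ ((q - 1) / 2)) h
  simp only [mul_pow, ← pow_mul] at h2
  rw [mul_comm e, mul_comm f, pow_mul, pow_mul, hp, one_pow, one_pow, mul_one] at h2
  rw [hN, h2]

lemma coeff_prod_top {R ι : Type*} [CommRing R] [DecidableEq ι] (s : Finset ι) (f : ι → R[X])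
    (d : ι → ℕ) (h : ∀ i ∈ s, (f i).natDegree ≤ d i) :
    (∏ i ∈ s, f i).natDegree ≤ ∑ i ∈ s, d i ∧
    (∏ i ∈ s, f i).coeff (∑ i ∈ s, d i) = ∏ i ∈ s, (f i).coeff (d i) := by
  induction s using Finset.induction_on with
  | empty => simp
  | insert a s ha ih =>
    obtain ⟨h1, h2⟩ := ih fun i hi => h i (Finset.mem_insert_of_mem hi)
    have h3 := h a (Finset.mem_insert_self _ _)
    rw [Finset.prod_insert ha, Finset.sum_insert ha, Finset.prod_insert ha]
    refine ⟨natDegree_mul_le_of_le h3 h1, ?_⟩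
    rw [coeff_mul_add_eq_of_natDegree_le h3 h1, h2]

lemma coeff_det_top {R ι : Type*} [CommRing R] [DecidableEq ι] [Fintype ι] (M : Matrix ι ι R[X])
    (d : ι → ℕ) (h : ∀ i j, (M i j).natDegree ≤ d j) :
    M.det.natDegree ≤ ∑ j, d j ∧
    M.det.coeff (∑ j, d j) = (Matrix.of fun i j => (M i j).coeff (d j)).det := by
  rw [Matrix.det_apply, Matrix.det_apply]
  constructor
  · refine natDegree_sum_le_of_forall_le _ _ fun σ _ => ?_
    refine (natDegree_smul_le _ _).trans ?_
    exact (coeff_prod_top _ _ _ fun i _ => h _ _).1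
  · rw [finsetSum_coeff]
    refine Finset.sum_congr rfl fun σ _ => ?_
    have := (coeff_prod_top univ (fun i => M (σ i) i) d fun i _ => h _ _).2
    rw [Units.smul_def, Units.smul_def, coeff_smul, this]
    rfl

lemma window_c {F : Type*} [Field F] [DecidableEq F] {n k ν : ℕ} (α b : F) (N : ℕ)
    (hα : orderOf α = N) (hα0 : α ≠ 0)
    (hb : ∀ e f : ℕ, α ^ e ≠ b * α ^ f) (hb0 : b ≠ 0) (hkn : k < n) (hN : n * (ν + 1) ≤ N)
    (c : ℕ → ℕ → F) (hc : ∀ i j, c i j = (1 - b * α ^ ((j : ℤ) - (i : ℤ)))⁻¹)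
    (S : Finset (Fin k × ℕ)) (hS : S.Nonempty) (hSν : ∀ p ∈ S, p.2 ≤ ν) (l : Fin k × ℕ → F)
    (hl : ∀ p ∈ S, l p ≠ 0) :
    n + 1 ≤ #{x : Fin n | ∑ p ∈ S, l p * c (p.2 * n + (x : ℕ)) (p.1 : ℕ) ≠ 0} + #S := by
  have hlt : ∀ r : Fin k, ∀ m ≤ ν, (r : ℕ) + m * n < n * (ν + 1) := by
    intro r m hm
    have := r.2
    nlinarith
  have key := alpha_zeros α b N hα hα0 hb hb0 (univ : Finset (Fin n)) S hS
    (fun x => ν * n + x) (fun p => p.1 + (ν - p.2) * n) l ?_ ?_ ?_ ?_ hl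
  · rw [Finset.card_univ, Fintype.card_fin] at key
    refine key.trans (Nat.add_le_add_right (Finset.card_le_card fun x hx => ?_) _)
    rw [Finset.mem_filter] at hx ⊢
    refine ⟨hx.1, ?_⟩
    convert hx.2 using 4 with p hp
    rw [hc]
    congr 4
    have := hSν p hp
    push_cast [Nat.cast_sub this]
    ring
  · intro x _ y _ h
    simp only at h
    ext; omega
  · intro p hp p' hp' h
    simp only at h
    have h1 := p.1.2
    have h2 := p'.1.2
    have h3 := hSν p hp
    have h4 := hSν p' hp'
    have e1 := congrArg (· % n) h
    have e2 := congrArg (· / n) h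
    simp only [Nat.add_mul_mod_self_right, Nat.add_mul_div_right _ _ (show 0 < n by omega)] at e1 e2
    rw [Nat.mod_eq_of_lt (by omega), Nat.mod_eq_of_lt (by omega)] at e1
    rw [Nat.div_eq_of_lt (by omega), Nat.div_eq_of_lt (by omega)] at e2
    ext
    · exact e1
    · omega
  · intro x _
    have := x.2
    nlinarith
  · intro p hp
    exact (hlt p.1 _ (Nat.sub_le _ _)).trans_le hN

lemma stack_c {F : Type*} [Field F] [DecidableEq F] {n k ν : ℕ} (α b : F) (N : ℕ)
    (hα : orderOf α = N) (hα0 : α ≠ 0)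
    (hb : ∀ e f : ℕ, α ^ e ≠ b * α ^ f) (hb0 : b ≠ 0) (hkn : k < n) (hN : n * (ν + 1) ≤ N)
    (c : ℕ → ℕ → F) (hc : ∀ i j, c i j = (1 - b * α ^ ((j : ℤ) - (i : ℤ)))⁻¹)
    (S : Finset (Fin k)) (hS : S.Nonempty) (l : Fin k → F)
    (hl : ∀ p ∈ S, l p ≠ 0) :
    n * ν + 1 ≤ ∑ i ∈ range ν, #{x : Fin n | ∑ r ∈ S, l r * c (i * n + (x : ℕ)) (r : ℕ) ≠ 0}
      + #S := by
  have key := alpha_zeros α b N hα hα0 hb hb0 ((range ν) ×ˢ (univ : Finset (Fin n))) S hS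
    (fun p => p.1 * n + p.2) (fun p => (p : ℕ)) l ?_ ?_ ?_ ?_ hl
  · rw [Finset.card_product, Finset.card_univ, Fintype.card_fin, Finset.card_range] at key
    rw [mul_comm]
    refine key.trans (Nat.add_le_add_right (le_of_eq ?_) _)
    rw [Finset.card_filter, Finset.sum_product]
    refine Finset.sum_congr rfl fun i _ => ?_
    rw [Finset.card_filter]
    simp only [hc]
  · rintro ⟨i, x⟩ _ ⟨j, y⟩ _ h
    simp only at h
    have h1 := x.2
    have h2 := y.2
    have e1 := congrArg (· % n) h
    have e2 := congrArg (· / n) h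
    simp only [Nat.add_comm (_ * n),
      Nat.add_mul_mod_self_right, Nat.add_mul_div_right _ _ (show 0 < n by omega)] at e1 e2
    rw [Nat.mod_eq_of_lt (by omega), Nat.mod_eq_of_lt (by omega)] at e1
    rw [Nat.div_eq_of_lt (by omega), Nat.div_eq_of_lt (by omega)] at e2
    ext
    · simpa using e2
    · exact e1
  · intro x _ y _ h
    exact Fin.ext h
  · rintro ⟨i, x⟩ h
    simp only [Finset.mem_product, Finset.mem_range] at h
    have := x.2
    have h1 : i + 1 ≤ ν := h.1
    simp only
    nlinarith
  · intro p hp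
    have := p.2
    nlinarith

lemma pw_ge {F : Type*} [Field F] [DecidableEq F] {n : ℕ} (v : Fin n → F[X]) (A : Finset ℕ) :
    ∑ s ∈ A, #{x : Fin n | (v x).coeff s ≠ 0} ≤ polyWeight v := by
  unfold polyWeight
  simp only [Finset.card_filter]
  rw [Finset.sum_comm]
  refine Finset.sum_le_sum fun x _ => ?_
  rw [← Finset.card_filter]
  refine Finset.card_le_card fun s hs => ?_
  rw [Finset.mem_filter] at hs
  exact mem_support_iff.mpr hs.2

lemma pw_ge_shift {F : Type*} [Field F] [DecidableEq F] {n : ℕ} (v : Fin n → F[X]) (d m : ℕ) :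
    ∑ i ∈ range m, #{x : Fin n | (v x).coeff (d + i) ≠ 0} ≤ polyWeight v := by
  refine le_trans (le_of_eq ?_) (pw_ge v ((range m).image (d + ·)))
  rw [Finset.sum_image]
  intro a _ b _ h
  simpa using h

lemma sum_e {k t : ℕ} (ht : t ≤ k) : ∑ r : Fin k, (if (r : ℕ) < t then 1 else 0) = t := by
  rw [Fin.sum_univ_eq_sum_range (fun r => if r < t then 1 else 0) k, ← Finset.card_filter]
  have : (range k).filter (· < t) = range t := by
    ext a; simp; omega
  rw [this, Finset.card_range]

lemma lower_single {F : Type*} [Field F] [DecidableEq F] {n k ν t : ℕ} (c : ℕ → ℕ → F)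
    (G : Matrix (Fin n) (Fin k) F[X])
    (hG : ∀ x r i, (G x r).coeff i =
      if i < ν + (if (r : ℕ) < t then 1 else 0) then c (i * n + (x : ℕ)) (r : ℕ) else 0)
    (W : ∀ (S : Finset (Fin k × ℕ)) (_ : S.Nonempty) (_ : ∀ p ∈ S, p.2 ≤ ν) (l : Fin k × ℕ → F)
      (_ : ∀ p ∈ S, l p ≠ 0),
      n + 1 ≤ #{x : Fin n | ∑ p ∈ S, l p * c (p.2 * n + (x : ℕ)) (p.1 : ℕ) ≠ 0} + #S)
    (St : ∀ (S : Finset (Fin k)) (_ : S.Nonempty) (l : Fin k → F) (_ : ∀ p ∈ S, l p ≠ 0),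
      n * ν + 1 ≤ ∑ i ∈ range ν, #{x : Fin n | ∑ r ∈ S, l r * c (i * n + (x : ℕ)) (r : ℕ) ≠ 0}
      + #S)
    (ht : t < k) (hn : 2 * t ≤ n + 1) (a : Fin k → F) (ha : a ≠ 0) (d : ℕ) :
    n * ν + t + 1 ≤ polyWeight (G.mulVec fun r => monomial d (a r)) + k := by
  set v := G.mulVec fun r => monomial d (a r) with hv
  have hco : ∀ x i, (v x).coeff (d + i) =
      ∑ r, (G x r).coeff i * a r := by
    intro x i
    simp only [hv, Matrix.mulVec, dotProduct, finsetSum_coeff]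
    refine Finset.sum_congr rfl fun r _ => ?_
    rw [add_comm d i, coeff_mul_monomial]
  set S : Finset (Fin k) := {r | a r ≠ 0} with hS
  have hSne : S.Nonempty := by
    obtain ⟨r, hr⟩ := Function.ne_iff.mp ha
    exact ⟨r, by simpa [hS] using hr⟩
  have hSt := St S hSne a (by simp [hS])
  have hco1 : ∀ x, ∀ i < ν, (v x).coeff (d + i) = ∑ r ∈ S, a r * c (i * n + (x : ℕ)) (r : ℕ) := by
    intro x i hi
    rw [hco, hS, Finset.sum_filter]
    refine Finset.sum_congr rfl fun r _ => ?_
    rw [hG, if_pos (by omega)]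
    split_ifs with h
    · ring
    · rw [not_not.mp h]; ring
  have hsum : ∑ i ∈ range ν, #{x : Fin n | ∑ r ∈ S, a r * c (i * n + (x : ℕ)) (r : ℕ) ≠ 0}
      = ∑ i ∈ range ν, #{x : Fin n | (v x).coeff (d + i) ≠ 0} := by
    refine Finset.sum_congr rfl fun i hi => ?_
    simp only [hco1 _ i (Finset.mem_range.mp hi)]
  rw [hsum] at hSt
  have hp := pw_ge_shift v d (ν + 1)
  rw [Finset.sum_range_succ] at hp
  have hSk : #S ≤ k := by simpa using Finset.card_le_univ S
  set T : Finset (Fin k) := {r | (r : ℕ) < t} with hT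
  have hTc : #T = t := by rw [hT, Finset.card_filter]; exact sum_e ht.le
  by_cases hex : (S ∩ T).Nonempty
  · have h1 := W ((S ∩ T) ×ˢ {ν}) (hex.product (Finset.singleton_nonempty ν))
      (by simp +contextual) (fun p => a p.1)
      (fun p hp => (Finset.mem_filter.mp
        (Finset.mem_inter.mp (Finset.mem_product.mp hp).1).1).2)
    rw [Finset.card_product, Finset.card_singleton, mul_one] at h1
    simp only [Finset.sum_product, Finset.sum_singleton] at h1
    have h2 : #(S ∩ T) ≤ t := hTc ▸ Finset.card_le_card Finset.inter_subset_right
    have h3 : ∀ x, (v x).coeff (d + ν) = ∑ r ∈ S ∩ T, a r * c (ν * n + (x : ℕ)) (r : ℕ) := by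
      intro x
      rw [hco, hS, hT, ← Finset.filter_and, Finset.sum_filter]
      refine Finset.sum_congr rfl fun r _ => ?_
      rw [hG]
      by_cases h : (r : ℕ) < t
      · by_cases h' : a r = 0 <;> simp [h, h', mul_comm]
      · simp [h]
    simp only [← h3] at h1
    omega
  · have h1 : #S + #T ≤ k := by
      rw [← Finset.card_union_of_disjoint]
      · simpa using Finset.card_le_univ (S ∪ T)
      · rw [Finset.disjoint_iff_inter_eq_empty]
        exact Finset.not_nonempty_iff_eq_empty.mp hex
    omega

lemma coeff_window {F : Type*} [Field F] [DecidableEq F] {n k ν t : ℕ} (c : ℕ → ℕ → F)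
    (G : Matrix (Fin n) (Fin k) F[X])
    (hG : ∀ x r i, (G x r).coeff i =
      if i < ν + (if (r : ℕ) < t then 1 else 0) then c (i * n + (x : ℕ)) (r : ℕ) else 0)
    (u : Fin k → F[X]) (x : Fin n) (s : ℕ) :
    ((G.mulVec u) x).coeff s = ∑ p ∈ ((univ : Finset (Fin k)) ×ˢ range (s + 1)).filter
      (fun p => p.2 < ν + (if (p.1 : ℕ) < t then 1 else 0) ∧ (u p.1).coeff (s - p.2) ≠ 0),
      (u p.1).coeff (s - p.2) * c (p.2 * n + (x : ℕ)) (p.1 : ℕ) := by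
  rw [Finset.sum_filter, Finset.sum_product]
  simp only [Matrix.mulVec, dotProduct, finsetSum_coeff]
  refine Finset.sum_congr rfl fun r _ => ?_
  rw [coeff_mul, Finset.Nat.sum_antidiagonal_eq_sum_range_succ_mk]
  refine Finset.sum_congr rfl fun i _ => ?_
  simp only [hG]
  by_cases h1 : i < ν + (if (r : ℕ) < t then 1 else 0)
  · by_cases h2 : (u r).coeff (s - i) = 0
    · simp [h2]
    · simp [h1, h2, mul_comm]
  · simp [h1]

open scoped Pointwise in
lemma lower_multi {F : Type*} [Field F] [DecidableEq F] {n k ν t : ℕ} (c : ℕ → ℕ → F)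
    (G : Matrix (Fin n) (Fin k) F[X])
    (hG : ∀ x r i, (G x r).coeff i =
      if i < ν + (if (r : ℕ) < t then 1 else 0) then c (i * n + (x : ℕ)) (r : ℕ) else 0)
    (W : ∀ (S : Finset (Fin k × ℕ)) (_ : S.Nonempty) (_ : ∀ p ∈ S, p.2 ≤ ν) (l : Fin k × ℕ → F)
      (_ : ∀ p ∈ S, l p ≠ 0),
      n + 1 ≤ #{x : Fin n | ∑ p ∈ S, l p * c (p.2 * n + (x : ℕ)) (p.1 : ℕ) ≠ 0} + #S)
    (hν : 0 < ν)
    (ht : t < k) (hn1 : k * ν + t ≤ n + 1) (hn2 : 2 * (k * ν) + 2 * t ≤ n + ν + k)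
    (u : Fin k → F[X]) (J : Finset ℕ) (hJ : ∀ j, j ∈ J ↔ ∃ r, (u r).coeff j ≠ 0)
    (hJ2 : 2 ≤ #J) :
    n * ν + t + 1 ≤ polyWeight (G.mulVec u) + k := by
  have hJne : J.Nonempty := Finset.card_pos.mp (by omega)
  set d := J.max' hJne with hd
  have hdJ : d ∈ J := J.max'_mem hJne
  have hdmax : ∀ j ∈ J, j ≤ d := fun j hj => J.le_max' j hj
  set A : Finset ℕ := J + range ν with hA
  have hAcard : #J + ν ≤ #A + 1 := by
    have := cauchy_davenport_add_of_linearOrder_isCancelAdd (s := J) (t := range ν) hJne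
      ⟨0, by simpa using hν⟩
    rw [Finset.card_range] at this
    have h' : #J + ν - 1 ≤ #A := by
      rw [hA]
      convert this
    omega
  have hAd : ∀ s ∈ A, s < d + ν := by
    intro s hs
    obtain ⟨j, hj, i, hi, rfl⟩ := Finset.mem_add.mp hs
    have := hdmax j hj
    have := Finset.mem_range.mp hi
    omega
  set S : ℕ → Finset (Fin k × ℕ) := fun s => ((univ : Finset (Fin k)) ×ˢ range (s + 1)).filter
      (fun p => p.2 < ν + (if (p.1 : ℕ) < t then 1 else 0) ∧ (u p.1).coeff (s - p.2) ≠ 0) with hS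
  have hwin : ∀ s ∈ A, n + 1 ≤ #{x : Fin n | ((G.mulVec u) x).coeff s ≠ 0} + #(S s) := by
    intro s hs
    simp only [coeff_window c G hG u _ s]
    refine W (S s) ?_ ?_ (fun p => (u p.1).coeff (s - p.2)) ?_
    · obtain ⟨j, hj, i, hi, rfl⟩ := Finset.mem_add.mp hs
      obtain ⟨r, hr⟩ := (hJ j).mp hj
      have := Finset.mem_range.mp hi
      refine ⟨(r, i), ?_⟩
      simp only [hS, Finset.mem_filter, Finset.mem_product, Finset.mem_univ, Finset.mem_range,
        true_and, Nat.add_sub_cancel]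
      exact ⟨by omega, by omega, hr⟩
    · intro p hp
      have := (Finset.mem_filter.mp hp).2.1
      split_ifs at this <;> omega
    · intro p hp
      exact (Finset.mem_filter.mp hp).2.2
  have hM : ∑ s ∈ A, #(S s) ≤ #J * (k * ν) + (#J - 1) * t := by
    set B : Finset (Σ _ : ℕ, Σ _ : Fin k, ℕ) := J.sigma fun j => (univ : Finset (Fin k)).sigma
      fun r => range (ν + if j = d then 0 else if (r : ℕ) < t then 1 else 0) with hB
    have hBcard : #B = #J * (k * ν) + (#J - 1) * t := by
      rw [hB, Finset.card_sigma]
      simp only [Finset.card_sigma, Finset.card_range, Finset.sum_add_distrib, Finset.sum_const,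
        Finset.card_univ, Fintype.card_fin, smul_eq_mul]
      congr 1
      rw [← Finset.add_sum_erase J _ hdJ, ← Finset.card_erase_of_mem hdJ]
      simp only [if_true, Finset.sum_const_zero, zero_add]
      rw [Finset.sum_congr rfl (g := fun _ => t), Finset.sum_const, smul_eq_mul]
      intro j hj
      simp only [if_neg (Finset.ne_of_mem_erase hj)]
      exact sum_e ht.le
    rw [← hBcard, ← Finset.card_sigma]
    refine Finset.card_le_card_of_injOn (fun p => ⟨p.1 - p.2.2, p.2.1, p.2.2⟩) ?_ ?_
    · rintro ⟨s, r, i⟩ hp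
      simp only [hS, Finset.coe_sigma, Set.mem_sigma_iff, Finset.mem_coe, Finset.mem_filter,
        Finset.mem_product, Finset.mem_range, Finset.mem_univ, true_and] at hp
      obtain ⟨hs, h1, h2, h3⟩ := hp
      simp only [hB, Finset.mem_coe, Finset.mem_sigma, Finset.mem_univ, Finset.mem_range, true_and]
      refine ⟨(hJ _).mpr ⟨r, h3⟩, ?_⟩
      have := hAd s hs
      split_ifs at h2 ⊢ <;> omega
    · rintro ⟨s, r, i⟩ hp ⟨s', r', i'⟩ hp' h
      simp only [hS, Finset.coe_sigma, Set.mem_sigma_iff, Finset.mem_coe, Finset.mem_filter,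
        Finset.mem_product, Finset.mem_range, Finset.mem_univ, true_and] at hp hp'
      simp only [Sigma.mk.injEq, heq_eq_eq] at h
      obtain ⟨h1, h2, h3⟩ := h
      subst h2 h3
      have : s = s' := by omega
      subst this
      rfl
  have hsum : #A * (n + 1) ≤ polyWeight (G.mulVec u) + ∑ s ∈ A, #(S s) := by
    have h1 := Finset.sum_le_sum hwin
    rw [Finset.sum_const, smul_eq_mul, Finset.sum_add_distrib] at h1
    have h2 := pw_ge (G.mulVec u) A
    omega
  obtain ⟨p, hp⟩ : ∃ p, #J = p + 2 := ⟨#J - 2, by omega⟩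
  rw [hp] at hM hAcard
  have e1 : p + 2 - 1 = p + 1 := by omega
  rw [e1] at hM
  have h3 : (p + 1 + ν) * (n + 1) ≤ #A * (n + 1) := Nat.mul_le_mul_right _ (by omega)
  have h4 : p * (k * ν + t) ≤ p * (n + 1) := Nat.mul_le_mul_left _ hn1
  nlinarith

lemma lower_all {F : Type*} [Field F] [DecidableEq F] {n k ν t : ℕ} (c : ℕ → ℕ → F)
    (G : Matrix (Fin n) (Fin k) F[X])
    (hG : ∀ x r i, (G x r).coeff i =
      if i < ν + (if (r : ℕ) < t then 1 else 0) then c (i * n + (x : ℕ)) (r : ℕ) else 0)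
    (W : ∀ (S : Finset (Fin k × ℕ)) (_ : S.Nonempty) (_ : ∀ p ∈ S, p.2 ≤ ν) (l : Fin k × ℕ → F)
      (_ : ∀ p ∈ S, l p ≠ 0),
      n + 1 ≤ #{x : Fin n | ∑ p ∈ S, l p * c (p.2 * n + (x : ℕ)) (p.1 : ℕ) ≠ 0} + #S)
    (St : ∀ (S : Finset (Fin k)) (_ : S.Nonempty) (l : Fin k → F) (_ : ∀ p ∈ S, l p ≠ 0),
      n * ν + 1 ≤ ∑ i ∈ range ν, #{x : Fin n | ∑ r ∈ S, l r * c (i * n + (x : ℕ)) (r : ℕ) ≠ 0}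
      + #S)
    (hν : 0 < ν)
    (ht : t < k) (hn1 : k * ν + t ≤ n + 1) (hn2 : 2 * (k * ν) + 2 * t ≤ n + ν + k)
    (u : Fin k → F[X]) (hu : u ≠ 0) :
    n * ν + t + 1 ≤ polyWeight (G.mulVec u) + k := by
  classical
  set J : Finset ℕ := univ.biUnion fun r => (u r).support with hJdef
  have hJ : ∀ j, j ∈ J ↔ ∃ r, (u r).coeff j ≠ 0 := by
    intro j; simp [hJdef]
  by_cases h2 : 2 ≤ #J
  · exact lower_multi c G hG W hν ht hn1 hn2 u J hJ h2
  · obtain ⟨r, hr⟩ := Function.ne_iff.mp hu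
    obtain ⟨j, hj⟩ : ∃ j, (u r).coeff j ≠ 0 := by
      by_contra! h
      exact hr (Polynomial.ext (by simpa using h))
    have huj : u = fun r => monomial j ((u r).coeff j) := by
      funext r'
      ext m
      rw [coeff_monomial]
      split_ifs with h
      · rw [h]
      · by_contra hm
        exact h2 (Finset.one_lt_card.mpr ⟨j, (hJ j).mpr ⟨r, hj⟩, m, (hJ m).mpr ⟨r', hm⟩, h⟩)
    rw [huj]
    refine lower_single c G hG W St ht ?_ _ ?_ j
    · nlinarith
    · exact fun h => hj (congrFun h r)

lemma upper_ex {F : Type*} [Field F] [DecidableEq F] {n k ν t : ℕ} (c : ℕ → ℕ → F)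
    (G : Matrix (Fin n) (Fin k) F[X])
    (hG : ∀ x r i, (G x r).coeff i =
      if i < ν + (if (r : ℕ) < t then 1 else 0) then c (i * n + (x : ℕ)) (r : ℕ) else 0)
    (hν : 0 < ν) (ht : t < k) (hkn : k < n) :
    ∃ u : Fin k → F[X], u ≠ 0 ∧ polyWeight (G.mulVec u) + k ≤ n * ν + t + 1 := by
  let M : Matrix (Fin (k - 1)) (Fin k) F := Matrix.of fun i r =>
    if h : (i : ℕ) < t then (if (r : ℕ) = i then 1 else 0)
    else (G ⟨i - t, by omega⟩ r).coeff 0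
  have hker : LinearMap.ker M.mulVecLin ≠ ⊥ := by
    apply LinearMap.ker_ne_bot_of_finrank_lt
    simp; omega
  obtain ⟨a, ha, ha0⟩ := Submodule.exists_mem_ne_zero_of_ne_bot hker
  rw [LinearMap.mem_ker, Matrix.mulVecLin_apply] at ha
  have hat : ∀ r : Fin k, (r : ℕ) < t → a r = 0 := by
    intro r hr
    have := congrFun ha ⟨r, by omega⟩
    simp only [M, Matrix.mulVec, dotProduct, Matrix.of_apply, hr, dif_pos, Pi.zero_apply,
      ite_mul, one_mul, zero_mul, ← Fin.ext_iff] at this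
    simpa using this
  have hcoef : ∀ x i, ((G.mulVec fun r => C (a r)) x).coeff i = ∑ r, (G x r).coeff i * a r := by
    intro x i
    simp only [Matrix.mulVec, dotProduct, finsetSum_coeff, coeff_mul_C]
  have hz : ∀ x : Fin n, (x : ℕ) < k - 1 - t → ((G.mulVec fun r => C (a r)) x).coeff 0 = 0 := by
    intro x hx
    rw [hcoef]
    have := congrFun ha ⟨x + t, by omega⟩
    simpa [M, Matrix.mulVec, dotProduct] using this
  have hdeg : ∀ x : Fin n, ∀ i, ν ≤ i → ((G.mulVec fun r => C (a r)) x).coeff i = 0 := by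
    intro x i hi
    rw [hcoef]
    refine Finset.sum_eq_zero fun r _ => ?_
    by_cases h : (r : ℕ) < t
    · rw [hat r h, mul_zero]
    · rw [hG, if_neg, zero_mul]
      simp [h, hi]
  refine ⟨fun r => C (a r), ?_, ?_⟩
  · intro h
    apply ha0
    funext r
    simpa using congrFun h r
  · have h1 : ∀ x : Fin n, ((G.mulVec fun r => C (a r)) x).support.card
        + (if (x : ℕ) < k - 1 - t then 1 else 0) ≤ ν := by
      intro x
      split_ifs with hx
      · have : ((G.mulVec fun r => C (a r)) x).support ⊆ (range ν).erase 0 := by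
          intro i hi
          rw [mem_support_iff] at hi
          rw [Finset.mem_erase, Finset.mem_range]
          refine ⟨?_, ?_⟩
          · rintro rfl; exact hi (hz x hx)
          · by_contra h; exact hi (hdeg x i (by omega))
        have := Finset.card_le_card this
        rw [Finset.card_erase_of_mem (by simpa using hν), Finset.card_range] at this
        omega
      · have : ((G.mulVec fun r => C (a r)) x).support ⊆ range ν := by
          intro i hi
          rw [mem_support_iff] at hi
          rw [Finset.mem_range]
          by_contra h; exact hi (hdeg x i (by omega))
        simpa using Finset.card_le_card this
    have h2 := Finset.sum_le_sum fun x (_ : x ∈ (univ : Finset (Fin n))) => h1 x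
    rw [Finset.sum_add_distrib, sum_e (by omega)] at h2
    simp only [Finset.sum_const, Finset.card_univ, Fintype.card_fin, smul_eq_mul] at h2
    unfold polyWeight
    omega

lemma minor_deg {F : Type*} [Field F] [DecidableEq F] {n k ν t : ℕ} (c : ℕ → ℕ → F)
    (G : Matrix (Fin n) (Fin k) F[X])
    (hG : ∀ x r i, (G x r).coeff i =
      if i < ν + (if (r : ℕ) < t then 1 else 0) then c (i * n + (x : ℕ)) (r : ℕ) else 0)
    (W : ∀ (S : Finset (Fin k × ℕ)) (_ : S.Nonempty) (_ : ∀ p ∈ S, p.2 ≤ ν) (l : Fin k × ℕ → F)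
      (_ : ∀ p ∈ S, l p ≠ 0),
      n + 1 ≤ #{x : Fin n | ∑ p ∈ S, l p * c (p.2 * n + (x : ℕ)) (p.1 : ℕ) ≠ 0} + #S)
    (hν : 0 < ν) (ht : t < k) (hkn : k < n) :
    maxMinorDeg G = k * (ν - 1) + t := by
  classical
  set D : Fin k → ℕ := fun r => (ν - 1) + (if (r : ℕ) < t then 1 else 0) with hD
  have hDsum : ∑ r, D r = k * (ν - 1) + t := by
    rw [hD, Finset.sum_add_distrib, sum_e ht.le]
    simp
  have hdeg : ∀ x r, (G x r).natDegree ≤ D r := by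
    intro x r
    rw [natDegree_le_iff_coeff_eq_zero]
    intro i hi
    rw [hG, if_neg]
    simp only [hD] at hi
    omega
  rw [← hDsum]
  unfold maxMinorDeg
  apply le_antisymm
  · refine Finset.sup_le fun f _ => ?_
    exact (coeff_det_top _ D fun i j => hdeg _ _).1
  · let f : Fin k → Fin n := Fin.castLE hkn.le
    refine le_trans ?_ (Finset.le_sup (Finset.mem_univ f))
    apply le_natDegree_of_ne_zero
    rw [(coeff_det_top (G.submatrix f id) D fun i j => hdeg _ _).2]
    intro h0
    obtain ⟨l, hl0, hl⟩ := Matrix.exists_mulVec_eq_zero_iff.mpr h0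
    set S : Finset (Fin k) := {r | l r ≠ 0} with hS
    have hSne : S.Nonempty := by
      obtain ⟨r, hr⟩ := Function.ne_iff.mp hl0
      exact ⟨r, by simpa [hS] using hr⟩
    have hinj : Function.Injective fun r : Fin k => (r, D r) := fun x y h => congrArg Prod.fst h
    have h1 := W (S.image fun r => (r, D r)) (hSne.image _) ?_ (fun p => l p.1) ?_
    · rw [Finset.card_image_of_injective _ hinj] at h1
      simp only [Finset.sum_image hinj.injOn] at h1
      have hSk : #S ≤ k := by simpa using Finset.card_le_univ S
      have hd : Disjoint ({x : Fin n | ∑ r ∈ S, l r * c (D r * n + (x : ℕ)) (r : ℕ) ≠ 0} :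
          Finset (Fin n)) (univ.image f) := by
        rw [Finset.disjoint_right]
        intro y hy
        obtain ⟨x, _, rfl⟩ := Finset.mem_image.mp hy
        simp only [Finset.mem_filter, Finset.mem_univ, true_and, not_not]
        have := congrFun hl x
        simp only [Matrix.mulVec, dotProduct, Matrix.of_apply, Matrix.submatrix_apply, id,
          Pi.zero_apply] at this
        rw [← this, hS, Finset.sum_filter]
        refine Finset.sum_congr rfl fun r _ => ?_
        have hlt : D r < ν + (if (r : ℕ) < t then 1 else 0) := by
          simp only [hD]; omega
        rw [hG, if_pos hlt]
        split_ifs with h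
        · rw [mul_comm]
        · rw [not_not.mp h, mul_zero]
      have h2 := Finset.card_le_univ (({x : Fin n | ∑ r ∈ S, l r * c (D r * n + (x : ℕ)) (r : ℕ) ≠ 0} :
          Finset (Fin n)) ∪ (univ.image f))
      rw [Finset.card_union_of_disjoint hd,
        Finset.card_image_of_injective _ (Fin.castLE_injective hkn.le)] at h2
      simp only [Finset.card_univ, Fintype.card_fin] at h2
      omega
    · intro p hp
      obtain ⟨r, _, rfl⟩ := Finset.mem_image.mp hp
      simp only [hD]
      split_ifs <;> omega
    · intro p hp
      obtain ⟨r, hr, rfl⟩ := Finset.mem_image.mp hp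
      simpa [hS] using hr

/-- Construction 1 for `δ ≥ k`: taking the coefficient vectors `g_{j,r}` of `G(z)` as
segments of the columns of the Cauchy circulant matrix `c_{ij} = 1/(1 - b α^{j-i})`,
namely `g_{j,r} = (c_{jn,r-1}, …, c_{(j+1)n-1,r-1})ᵀ`, yields a generator matrix of an MDS
convolutional code of rate `k/n` and degree `δ`, i.e. the code generated by `G(z)` has
degree `δ` and free distance `(n-k)(⌊δ/k⌋+1) + δ + 1`.  (Columns are indexed here from
`0` to `k-1`, so `r-1` becomes `r`.) -/
theorem construction1_large_delta {F : Type*} [Field F] [Fintype F]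
    {n k δ q : ℕ} (hk : 0 < k) (hkδ : k ≤ δ) (hkn : k < n)
    (ν t μ : ℕ) (hν : ν = δ / k + 1) (ht : t = δ - k * (δ / k))
    (hμ : μ = if t = 0 then ν - 1 else ν)
    (hn : n ≥ k + 2 * δ - ν)
    (hq : Fintype.card F = q) (hodd : Odd q)
    (hqsize : q ≥ 2 * n * (ν + 1) + 1)
    (α : F) (hα : orderOf α = (q - 1) / 2)
    (b : F) (hb : ¬ IsSquare b)
    (c : ℕ → ℕ → F)
    (hc : ∀ i j, c i j = (1 - b * α ^ ((j : ℤ) - (i : ℤ)))⁻¹)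
    (G : Matrix (Fin n) (Fin k) (Polynomial F))
    (hG : ∀ (x : Fin n) (r : Fin k),
      G x r = ∑ i ∈ Finset.range (μ + 1),
        Polynomial.C (if i < ν ∨ (r : ℕ) < t then c (i * n + (x : ℕ)) (r : ℕ) else 0)
          * Polynomial.X ^ i) :
    (∀ u : Fin k → Polynomial F, G.mulVec u = 0 → u = 0)
    ∧ maxMinorDeg G = δ
    ∧ freeDist G = (n - k) * (δ / k + 1) + δ + 1 := by
  classical
  have hN : n * (ν + 1) ≤ (q - 1) / 2 := by
    rw [Nat.le_div_iff_mul_le (by norm_num)]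
    have : 2 * n * (ν + 1) = n * (ν + 1) * 2 := by ring
    omega
  have hN0 : 0 < (q - 1) / 2 := lt_of_lt_of_le (Nat.mul_pos (by omega) (by omega)) hN
  have hα0 : α ≠ 0 := by
    rintro rfl
    have := pow_orderOf_eq_one (0 : F)
    rw [hα, zero_pow hN0.ne'] at this
    exact zero_ne_one this
  have hb0 : b ≠ 0 := by rintro rfl; exact hb IsSquare.zero
  have hne := alpha_ne hq hodd α hα b hb
  have htk : t < k := by
    rw [ht, ← Nat.mod_eq_sub_mul_div]
    exact Nat.mod_lt _ hk
  have hδ : δ = k * (ν - 1) + t := by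
    have := Nat.mul_div_le δ k
    rw [hν, ht, Nat.add_sub_cancel]
    exact (Nat.add_sub_cancel' this).symm
  have hν0 : 0 < ν := by rw [hν]; exact Nat.succ_pos _
  have hνδ : ν ≤ δ + 1 := by
    have := Nat.div_le_self δ k
    omega
  have hkν : k * ν = k * (ν - 1) + k := by
    obtain ⟨m, rfl⟩ : ∃ m, ν = m + 1 := ⟨ν - 1, by omega⟩
    rw [Nat.add_sub_cancel]; ring
  have hGc : ∀ x r i, (G x r).coeff i =
      if i < ν + (if (r : ℕ) < t then 1 else 0) then c (i * n + (x : ℕ)) (r : ℕ) else 0 := by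
    intro x r i
    rw [hG, finsetSum_coeff]
    simp only [coeff_C_mul_X_pow]
    rw [Finset.sum_ite_eq]
    simp only [Finset.mem_range]
    split_ifs at hμ ⊢ <;> first | rfl | omega
  have W := window_c (k := k) α b _ hα hα0 hne hb0 hkn hN c hc
  have St := stack_c (k := k) α b _ hα hα0 hne hb0 hkn hN c hc
  have low := lower_all c G hGc W St hν0 htk (by omega) (by omega)
  have hnν : n * ν = (n - k) * ν + k * ν := by
    rw [← Nat.add_mul, Nat.sub_add_cancel hkn.le]
  have hnz : ∀ u : Fin k → F[X], u ≠ 0 → G.mulVec u ≠ 0 := by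
    intro u hu h0
    have := low u hu
    rw [h0] at this
    have hz : polyWeight (0 : Fin n → F[X]) = 0 := by simp [polyWeight]
    rw [hz] at this
    omega
  refine ⟨?_, ?_, ?_⟩
  · intro u h
    by_contra hu
    exact hnz u hu h
  · rw [minor_deg c G hGc W hν0 htk hkn, hδ]
  · obtain ⟨u, hu, huw⟩ := upper_ex c G hGc hν0 htk hkn
    rw [← hν]
    have hlow := low u hu
    unfold freeDist
    apply le_antisymm
    · refine le_trans (Nat.sInf_le ⟨u, hnz u hu, rfl⟩) ?_
      omega
    · refine le_csInf ⟨_, u, hnz u hu, rfl⟩ ?_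
      rintro w ⟨u', hu', rfl⟩
      have := low u' (by rintro rfl; exact hu' (Matrix.mulVec_zero G))
      omega
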